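/- Let α > 0, 0 ≤ s < t, and suppose ν is a finite signed measure on the Borel subsets of (s,t] with ν((a,b]) = g(b) − g(a) for all s < a ≤ b ≤ t, where g : (s,t] → ℝ. Assume v ↦ e^{−α(v−s)} g(v) is Lebesgue integrable on (s,t] and lim_{v ↓ s} (1 − e^{−α(v−s)}) g(v) = 0. For u ∈ (s,t] define K(u) := e^{−α(u−s)} g(u) + ∫_{(s,u]} (e^{−α(u−v)} − e^{−α(u−s)}) ν(dv), and assume u ↦ K(u) is Lebesgue integrable on (s,t]. Then K(t) + α ∫_s^t K(u) du = g(t). -/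

import Mathlib

open MeasureTheory

/-- The integral of `f` over the set `A` with respect to the finite signed measure `μ`,
defined via the Jordan decomposition. -/
noncomputable def sintegralOn (μ : SignedMeasure ℝ) (A : Set ℝ) (f : ℝ → ℝ) : ℝ :=
  (∫ x in A, f x ∂μ.toJordanDecomposition.posPart)
    - ∫ x in A, f x ∂μ.toJordanDecomposition.negPart

/-- The exponential kernel truncated to `v ≤ u`, as a function of the pair `(u, v)`. -/
noncomputable def causalExp (α : ℝ) (p : ℝ × ℝ) : ℝ :=
  {p : ℝ × ℝ | p.2 ≤ p.1}.indicator (fun p => Real.exp (-α * (p.1 - p.2))) p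

lemma measurable_causalExp (α : ℝ) : Measurable (causalExp α) :=
  Measurable.indicator (by fun_prop) (measurableSet_le measurable_snd measurable_fst)

lemma norm_causalExp_le_one {α : ℝ} (hα : 0 ≤ α) (p : ℝ × ℝ) : ‖causalExp α p‖ ≤ 1 := by
  unfold causalExp
  by_cases h : p ∈ {p : ℝ × ℝ | p.2 ≤ p.1}
  · rw [Set.indicator_of_mem h, Real.norm_eq_abs, abs_of_pos (Real.exp_pos _), Real.exp_le_one_iff]
    have : 0 ≤ α * (p.1 - p.2) := mul_nonneg hα (sub_nonneg.2 h)
    linarith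
  · simp [Set.indicator_of_notMem h]

lemma integrable_causalExp {α : ℝ} (hα : 0 ≤ α) (μ : Measure (ℝ × ℝ)) [IsFiniteMeasure μ] :
    Integrable (causalExp α) μ :=
  Integrable.of_bound (measurable_causalExp α).aestronglyMeasurable 1
    (ae_of_all _ (norm_causalExp_le_one hα))

lemma setIntegral_causalExp_snd (α : ℝ) (P : Measure ℝ) {s t u : ℝ} (hu : u ≤ t) :
    ∫ v in Set.Ioc s t, causalExp α (u, v) ∂P
      = ∫ v in Set.Ioc s u, Real.exp (-α * (u - v)) ∂P := by
  have h : (fun v => causalExp α (u, v))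
      = (Set.Iic u).indicator (fun v => Real.exp (-α * (u - v))) := by
    ext v
    simp [causalExp, Set.indicator_apply]
  rw [h, setIntegral_indicator measurableSet_Iic]
  congr 2
  ext v
  simp only [Set.mem_inter_iff, Set.mem_Ioc, Set.mem_Iic]
  exact ⟨fun h => ⟨h.1.1, h.2⟩, fun h => ⟨⟨h.1, h.2.trans hu⟩, h.2⟩⟩

lemma mul_setIntegral_exp (α : ℝ) {v t : ℝ} (hv : v ≤ t) :
    α * ∫ u in Set.Ioc v t, Real.exp (-α * (u - v)) = 1 - Real.exp (-α * (t - v)) := by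
  rw [← intervalIntegral.integral_of_le hv, ← intervalIntegral.integral_const_mul]
  have hderiv : ∀ u ∈ Set.uIcc v t, HasDerivAt (fun u => -Real.exp (-α * (u - v)))
      (α * Real.exp (-α * (u - v))) u := fun u _ => by
    have h1 : HasDerivAt (fun u => -α * (u - v)) (-α * 1) u :=
      ((hasDerivAt_id u).sub_const v).const_mul (-α)
    exact h1.exp.neg.congr_deriv (by ring)
  rw [intervalIntegral.integral_eq_sub_of_hasDerivAt hderiv
    (Continuous.intervalIntegrable (by fun_prop) _ _)]
  simp
  ring

lemma mul_setIntegral_causalExp_fst (α : ℝ) {s t v : ℝ} (hv : v ∈ Set.Ioc s t) :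
    α * ∫ u in Set.Ioc s t, causalExp α (u, v) = 1 - Real.exp (-α * (t - v)) := by
  have h : (fun u => causalExp α (u, v))
      = (Set.Ici v).indicator (fun u => Real.exp (-α * (u - v))) := by
    ext u
    simp [causalExp, Set.indicator_apply]
  have hset : Set.Ioc s t ∩ Set.Ici v = Set.Icc v t := by
    ext u
    simp only [Set.mem_inter_iff, Set.mem_Ioc, Set.mem_Ici, Set.mem_Icc]
    exact ⟨fun h => ⟨h.2, h.1.2⟩, fun h => ⟨⟨hv.1.trans_le h.1, h.2⟩, h.1⟩⟩
  rw [h, setIntegral_indicator measurableSet_Ici, hset, integral_Icc_eq_integral_Ioc,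
    mul_setIntegral_exp α hv.2]

lemma integrableOn_setIntegral_exp {α : ℝ} (hα : 0 ≤ α) (s t : ℝ) (P : Measure ℝ)
    [IsFiniteMeasure P] :
    IntegrableOn (fun u => ∫ v in Set.Ioc s u, Real.exp (-α * (u - v)) ∂P) (Set.Ioc s t) := by
  have h := (integrable_causalExp hα
    ((volume.restrict (Set.Ioc s t)).prod (P.restrict (Set.Ioc s t)))).integral_prod_left
  refine (integrableOn_congr_fun (fun u hu => ?_) measurableSet_Ioc).1 h
  exact setIntegral_causalExp_snd α P hu.2

lemma integrable_exp_setIoc (α u s t : ℝ) (P : Measure ℝ) [IsFiniteMeasure P] :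
    IntegrableOn (fun v => Real.exp (-α * (u - v))) (Set.Ioc s t) P :=
  (Continuous.integrableOn_Icc (by fun_prop)).mono_set Set.Ioc_subset_Icc_self

/-- The exponential kernel identity for a finite measure. -/
lemma setIntegral_exp_add_mul_integral {α : ℝ} (hα : 0 ≤ α) (s t : ℝ) (P : Measure ℝ)
    [IsFiniteMeasure P] :
    (∫ v in Set.Ioc s t, Real.exp (-α * (t - v)) ∂P)
      + α * ∫ u in Set.Ioc s t, ∫ v in Set.Ioc s u, Real.exp (-α * (u - v)) ∂P
      = P.real (Set.Ioc s t) := by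
  have hint := integrable_causalExp hα
    ((volume.restrict (Set.Ioc s t)).prod (P.restrict (Set.Ioc s t)))
  have h1 : ∫ u in Set.Ioc s t, ∫ v in Set.Ioc s u, Real.exp (-α * (u - v)) ∂P
      = ∫ v in Set.Ioc s t, (∫ u in Set.Ioc s t, causalExp α (u, v)) ∂P := by
    rw [setIntegral_congr_fun measurableSet_Ioc
      fun u hu => (setIntegral_causalExp_snd α P (s := s) hu.2).symm]
    exact integral_integral_swap hint
  rw [h1, ← integral_const_mul, setIntegral_congr_fun measurableSet_Ioc
      fun v hv => mul_setIntegral_causalExp_fst α hv,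
    integral_sub (integrable_const _) (integrable_exp_setIoc α t s t P)]
  simp

lemma MeasureTheory.SignedMeasure.apply_eq_posPart_sub_negPart {X : Type*} [MeasurableSpace X]
    (ν : SignedMeasure X) {A : Set X} (hA : MeasurableSet A) :
    ν A = ν.toJordanDecomposition.posPart.real A - ν.toJordanDecomposition.negPart.real A := by
  conv_lhs => rw [← ν.toSignedMeasure_toJordanDecomposition]
  simp [JordanDecomposition.toSignedMeasure, hA]

/-- Kernel identity for the Ornstein–Uhlenbeck equation, bounded-variation case:
with `ν = g(dv,s)` the signed Lebesgue–Stieltjes measure of `g` on `(s,t]` and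
`K(u) = e^{-α(u-s)} g(u) + ∫_{(s,u]} (e^{-α(u-v)} - e^{-α(u-s)}) ν(dv)` one has
`K(t) + α ∫_s^t K(u) du = g(t)`. -/
theorem OU_kernel_identity_bv
    (α s t : ℝ) (hα : 0 < α) (hs : 0 ≤ s) (hst : s < t)
    (g : ℝ → ℝ) (ν : SignedMeasure ℝ)
    (hν : ∀ a b : ℝ, s < a → a ≤ b → b ≤ t → ν (Set.Ioc a b) = g b - g a)
    (hsupp : ν.totalVariation (Set.Ioc s t)ᶜ = 0)
    (hgint : IntegrableOn (fun v => Real.exp (-α * (v - s)) * g v) (Set.Ioc s t))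
    (hlim : Filter.Tendsto (fun v => (1 - Real.exp (-α * (v - s))) * g v)
      (nhdsWithin s (Set.Ioi s)) (nhds 0))
    (K : ℝ → ℝ)
    (hK : ∀ u ∈ Set.Ioc s t, K u = Real.exp (-α * (u - s)) * g u
      + sintegralOn ν (Set.Ioc s u)
          (fun v => Real.exp (-α * (u - v)) - Real.exp (-α * (u - s))))
    (hKint : IntegrableOn K (Set.Ioc s t)) :
    K t + α * ∫ u in s..t, K u = g t := by
  set P := ν.toJordanDecomposition.posPart
  set N := ν.toJordanDecomposition.negPart
  set c := g t - ν (Set.Ioc s t) with hc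
  have hνPN : ∀ u, ν (Set.Ioc s u) = P.real (Set.Ioc s u) - N.real (Set.Ioc s u) :=
    fun u => ν.apply_eq_posPart_sub_negPart measurableSet_Ioc
  have hg : ∀ u ∈ Set.Ioc s t, g u = c + ν (Set.Ioc s u) := fun u hu => by
    have h1 : ν (Set.Ioc s t) = ν (Set.Ioc s u) + ν (Set.Ioc u t) := by
      rw [← VectorMeasure.of_union (Set.Ioc_disjoint_Ioc_of_le le_rfl) measurableSet_Ioc
        measurableSet_Ioc, Set.Ioc_union_Ioc_eq_Ioc hu.1.le hu.2]
    have h2 := hν u t hu.1 hu.2 le_rfl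
    linarith
  have hK' : ∀ u ∈ Set.Ioc s t, K u = c * Real.exp (-α * (u - s))
      + ((∫ v in Set.Ioc s u, Real.exp (-α * (u - v)) ∂P)
        - ∫ v in Set.Ioc s u, Real.exp (-α * (u - v)) ∂N) := fun u hu => by
    have hsub (Q : Measure ℝ) [IsFiniteMeasure Q] :
        ∫ v in Set.Ioc s u, (Real.exp (-α * (u - v)) - Real.exp (-α * (u - s))) ∂Q
          = (∫ v in Set.Ioc s u, Real.exp (-α * (u - v)) ∂Q)
            - Q.real (Set.Ioc s u) * Real.exp (-α * (u - s)) := by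
      rw [integral_sub (integrable_exp_setIoc α u s u Q) (integrable_const _)]
      simp
    rw [hK u hu, hg u hu, hνPN, sintegralOn, hsub, hsub]
    ring
  have hPi := integrableOn_setIntegral_exp hα.le s t P
  have hNi := integrableOn_setIntegral_exp hα.le s t N
  have hei : IntegrableOn (fun u => c * Real.exp (-α * (u - s))) (Set.Ioc s t) :=
    (Continuous.integrableOn_Icc (by fun_prop)).mono_set Set.Ioc_subset_Icc_self
  have hexp : α * ∫ u in Set.Ioc s t, Real.exp (-α * (u - s)) = 1 - Real.exp (-α * (t - s)) :=
    mul_setIntegral_exp α hst.le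
  rw [intervalIntegral.integral_of_le hst.le, setIntegral_congr_fun measurableSet_Ioc hK',
    integral_add hei (show Integrable (fun u => _ - _) _ from hPi.sub hNi), integral_sub hPi hNi, integral_const_mul,
    hK' t ⟨hst, le_rfl⟩]
  have hP := setIntegral_exp_add_mul_integral hα.le s t P
  have hN := setIntegral_exp_add_mul_integral hα.le s t N
  have hνt := hνPN t
  linear_combination c * hexp + hP - hN - hνt
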